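/- arXiv:2210.00055 — 2 statements merged into one kernel-verified Lean document; each statement's English description precedes it below -/
import Mathlib

section
/- Let n and m be natural numbers, Z an n × m real matrix such that Z * Zᵀ is invertible, S, Y ∈ ℝⁿ, and ŵ ∈ ℝ with ŵ ≠ 0. Define θ⁻ := Zᵀ.mulVec ((Z * Zᵀ)⁻¹.mulVec Y), θ⁺ := Zᵀ.mulVec ((Z * Zᵀ)⁻¹.mulVec (Y − ŵ • S)), and β := Zᵀ.mulVec ((Z * Zᵀ)⁻¹.mulVec S). Then for any test point (z, s) ∈ ℝᵐ × ℝ, the two models agree, i.e., Σᵢ θ⁻ᵢ zᵢ = Σᵢ θ⁺ᵢ zᵢ + ŵ · s, if and only if s = Σᵢ βᵢ zᵢ. -/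
open Matrix

/-- Closed-form version of Proposition 2: the masked and unmasked models agree
at a test point `(z, s)` iff `s = βᵀ z`, where `β = Zᵀ(ZZᵀ)⁻¹S`. -/
theorem models_agree_iff_no_covariate_shift {n m : ℕ}
    (Z : Matrix (Fin n) (Fin m) ℝ) (hZ : IsUnit (Z * Zᵀ))
    (S Y : Fin n → ℝ) (what : ℝ) (hw : what ≠ 0)
    (θminus θplus β : Fin m → ℝ)
    (hminus : θminus = Zᵀ.mulVec ((Z * Zᵀ)⁻¹.mulVec Y))
    (hplus : θplus = Zᵀ.mulVec ((Z * Zᵀ)⁻¹.mulVec (Y - what • S)))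
    (hβ : β = Zᵀ.mulVec ((Z * Zᵀ)⁻¹.mulVec S))
    (z : Fin m → ℝ) (s : ℝ) :
    (∑ i, θminus i * z i) = (∑ i, θplus i * z i) + what * s ↔
      s = ∑ i, β i * z i := by
  have hθ : θplus = θminus - what • β := by
    rw [hplus, hminus, hβ]
    simp only [mulVec_sub, mulVec_smul]
  have hsum : ∑ i, θplus i * z i = ∑ i, θminus i * z i - what * ∑ i, β i * z i := by
    change θplus ⬝ᵥ z = θminus ⬝ᵥ z - what * (β ⬝ᵥ z)
    rw [hθ, sub_dotProduct, smul_dotProduct, smul_eq_mul]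
  rw [hsum]
  constructor
  · intro h
    exact mul_left_cancel₀ hw (by linarith)
  · rintro rfl
    ring
end

section
/- Let n and m be natural numbers, Z an n × m real matrix such that Z * Zᵀ is invertible, and S, Y ∈ ℝⁿ. Suppose (θ⁺, ŵ) ∈ ℝᵐ × ℝ satisfies Z.mulVec θ⁺ + ŵ • S = Y and minimizes Σᵢ (θᵢ)² + w² over all (θ, w) with Z.mulVec θ + w • S = Y, and that ŵ ≠ 0. Suppose θ⁻ ∈ ℝᵐ satisfies Z.mulVec θ⁻ = Y and minimizes Σᵢ (θᵢ)² over all θ with Z.mulVec θ = Y. Then for any test point (z, s) ∈ ℝᵐ × ℝ, the two models agree on the predicted output, i.e., Σᵢ θ⁻ᵢ zᵢ = Σᵢ θ⁺ᵢ zᵢ + ŵ · s, if and only if s = Σᵢ (Zᵀ.mulVec ((Z * Zᵀ)⁻¹.mulVec S))ᵢ zᵢ. -/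
open Matrix

/-- A least-norm solution of `Z θ = b` is `Zᵀ (Z Zᵀ)⁻¹ b` when `Z Zᵀ` is invertible. -/
theorem eq_transpose_mulVec_inv_of_min_norm {m n : Type*} [Fintype m] [Fintype n] [DecidableEq n]
    (Z : Matrix n m ℝ) (hZ : IsUnit (Z * Zᵀ)) (b : n → ℝ) (θ : m → ℝ) (hfit : Z *ᵥ θ = b)
    (hmin : ∀ θ' : m → ℝ, Z *ᵥ θ' = b → ∑ i, θ i ^ 2 ≤ ∑ i, θ' i ^ 2) :
    θ = Zᵀ *ᵥ ((Z * Zᵀ)⁻¹ *ᵥ b) := by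
  set u := (Z * Zᵀ)⁻¹ *ᵥ b with hu
  have hfit' : Z *ᵥ (Zᵀ *ᵥ u) = b := by
    rw [hu, mulVec_mulVec, mulVec_mulVec,
      mul_nonsing_inv _ ((isUnit_iff_isUnit_det _).mp hZ), one_mulVec]
  have horth : (θ - Zᵀ *ᵥ u) ⬝ᵥ (Zᵀ *ᵥ u) = 0 := by
    rw [dotProduct_mulVec, vecMul_transpose, mulVec_sub, hfit, hfit', sub_self, zero_dotProduct]
  have hle := hmin _ hfit'
  have hsq (v : m → ℝ) : ∑ i, v i ^ 2 = v ⬝ᵥ v := by simp [dotProduct, sq]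
  rw [hsq, hsq] at hle
  have hzero : (θ - Zᵀ *ᵥ u) ⬝ᵥ (θ - Zᵀ *ᵥ u) = 0 := by
    refine le_antisymm ?_ (hsq (θ - Zᵀ *ᵥ u) ▸ Finset.sum_nonneg fun i _ => sq_nonneg _)
    simp only [sub_dotProduct, dotProduct_sub, dotProduct_comm (Zᵀ *ᵥ u) θ] at horth ⊢
    linarith
  exact sub_eq_zero.mp (dotProduct_self_eq_zero.mp hzero)

/-- Proposition 2: the min-norm model trained with the feature `S` and the
min-norm model trained without it agree at a test point `(z, s)` iff
`s = (Zᵀ(ZZᵀ)⁻¹S)ᵀ z`, i.e., there is no covariate shift between `s` and `z`. -/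
theorem masktune_selective_agreement {n m : ℕ}
    (Z : Matrix (Fin n) (Fin m) ℝ) (hZ : IsUnit (Z * Zᵀ))
    (S Y : Fin n → ℝ)
    (θplus : Fin m → ℝ) (what : ℝ)
    (hplus_fit : Z.mulVec θplus + what • S = Y)
    (hplus_min : ∀ (θ : Fin m → ℝ) (w : ℝ), Z.mulVec θ + w • S = Y →
      ∑ i, (θplus i) ^ 2 + what ^ 2 ≤ ∑ i, (θ i) ^ 2 + w ^ 2)
    (hw : what ≠ 0)
    (θminus : Fin m → ℝ)
    (hminus_fit : Z.mulVec θminus = Y)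
    (hminus_min : ∀ θ : Fin m → ℝ, Z.mulVec θ = Y →
      ∑ i, (θminus i) ^ 2 ≤ ∑ i, (θ i) ^ 2)
    (z : Fin m → ℝ) (s : ℝ) :
    (∑ i, θminus i * z i) = (∑ i, θplus i * z i) + what * s ↔
      s = ∑ i, (Zᵀ.mulVec ((Z * Zᵀ)⁻¹.mulVec S)) i * z i := by
  have hm := eq_transpose_mulVec_inv_of_min_norm Z hZ Y θminus hminus_fit hminus_min
  have hp := eq_transpose_mulVec_inv_of_min_norm Z hZ (Y - what • S) θplus
    (eq_sub_of_add_eq hplus_fit) fun θ hθ =>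
      le_of_add_le_add_right (hplus_min θ what (by rw [hθ, sub_add_cancel]))
  rw [mulVec_sub, mulVec_sub, mulVec_smul, mulVec_smul, ← hm] at hp
  change θminus ⬝ᵥ z = θplus ⬝ᵥ z + what * s ↔ s = (Zᵀ *ᵥ ((Z * Zᵀ)⁻¹ *ᵥ S)) ⬝ᵥ z
  rw [hp, sub_dotProduct, smul_dotProduct, smul_eq_mul, ← mul_right_inj' hw (b := s)]
  constructor <;> intro h <;> linarith
end
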